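/- Let Γ be a finitely generated, residually finite group, (Γ_i) a nested sequence of finite-index normal subgroups with trivial intersection, and 1 ≤ p < ∞. If the box space □_{(Γ_i)}Γ admits a coarse embedding into an L^p space, then Γ has property PL^p, i.e. Γ admits a proper isometric affine action on some L^p space. -/

import Mathlib

open Filter

open scoped ENNReal

/-- `dist` on `Γ` is the word metric associated with the finite generating set `S`. -/
def IsWordMetric {Γ : Type*} [Group Γ] [MetricSpace Γ] (S : Set Γ) : Prop :=
  S.Finite ∧ Subgroup.closure S = ⊤ ∧
    ∀ g h : Γ, dist g h = sInf {t : ℝ | ∃ w : List Γ,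
      (w.length : ℝ) = t ∧ (∀ x ∈ w, x ∈ S ∨ x⁻¹ ∈ S) ∧ g⁻¹ * h = w.prod}

/-- `X` is the box space of `Γ` along the sequence of subgroups `Γi`. -/
structure IsBoxSpace (Γ : Type*) [Group Γ] [MetricSpace Γ] (Γi : ℕ → Subgroup Γ)
    (X : Type*) [MetricSpace X] where
  emb : (Σ i, Γ ⧸ Γi i) ≃ X
  dist_block : ∀ (i : ℕ) (a b : Γ ⧸ Γi i),
    dist (emb ⟨i, a⟩) (emb ⟨i, b⟩) =
      sInf {t : ℝ | ∃ g h : Γ, (g : Γ ⧸ Γi i) = a ∧ (h : Γ ⧸ Γi i) = b ∧ t = dist g h}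
  separated : ∀ R : ℝ, ∃ N : ℕ, ∀ (i j : ℕ) (a : Γ ⧸ Γi i) (b : Γ ⧸ Γi j),
    i ≠ j → (N ≤ i ∨ N ≤ j) → R ≤ dist (emb ⟨i, a⟩) (emb ⟨j, b⟩)

/-- `f` is a coarse embedding of `X` into `B`. -/
def IsCoarseEmbedding {X B : Type*} [MetricSpace X] [NormedAddCommGroup B]
    (f : X → B) : Prop :=
  ∃ ρ₁ ρ₂ : ℝ → ℝ, Monotone ρ₁ ∧ Monotone ρ₂ ∧
    Tendsto ρ₁ atTop atTop ∧ Tendsto ρ₂ atTop atTop ∧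
    ∀ x y : X, ρ₁ (dist x y) ≤ ‖f x - f y‖ ∧ ‖f x - f y‖ ≤ ρ₂ (dist x y)

/-- Property PL^p: Γ admits a proper isometric affine action on some L^p space. -/
def HasPropertyPLp (Γ : Type*) [Group Γ] (p : ℝ≥0∞) [Fact (1 ≤ p)] : Prop :=
  ∃ (α : Type) (_ : MeasurableSpace α) (μ : MeasureTheory.Measure α)
    (π : Γ → (MeasureTheory.Lp ℝ p μ ≃ₗᵢ[ℝ] MeasureTheory.Lp ℝ p μ))
    (b : Γ → MeasureTheory.Lp ℝ p μ),
    (∀ g h : Γ, ∀ v, π (g * h) v = π g (π h v)) ∧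
    (∀ g h : Γ, b (g * h) = π g (b h) + b g) ∧
    Filter.Tendsto (fun g : Γ => ‖b g‖) Filter.cofinite Filter.atTop

namespace BoxPL

open MeasureTheory Topology

/-- Weighted composition operators as a linear equivalence of `C(Q, ℝ)`. -/
noncomputable def wcomp {G Q : Type*} [Group G] [TopologicalSpace Q]
    (y : G → C(Q, ℝ)) (θ : G → C(Q, Q)) (h1 : y 1 = 1) (h2 : θ 1 = ContinuousMap.id Q)
    (h3 : ∀ h k, y (h * k) = y h * (y k).comp (θ h))
    (h4 : ∀ h k, θ (h * k) = (θ k).comp (θ h)) (g : G) : C(Q, ℝ) ≃ₗ[ℝ] C(Q, ℝ) where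
  toFun F := y g * F.comp (θ g)
  map_add' F F' := by ext q; simp [mul_add]
  map_smul' c F := by ext q; simp
  invFun F := y g⁻¹ * F.comp (θ g⁻¹)
  left_inv F := by
    have e1 := h3 g⁻¹ g
    have e2 := h4 g⁻¹ g
    rw [inv_mul_cancel, h1] at e1
    rw [inv_mul_cancel, h2] at e2
    ext q
    have e1' := DFunLike.congr_fun e1 q
    have e2' := DFunLike.congr_fun e2 q
    simp at e1' e2' ⊢
    rw [← mul_assoc, ← e1', ← e2', one_mul]
  right_inv F := by
    have e1 := h3 g g⁻¹
    have e2 := h4 g g⁻¹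
    rw [mul_inv_cancel, h1] at e1
    rw [mul_inv_cancel, h2] at e2
    ext q
    have e1' := DFunLike.congr_fun e1 q
    have e2' := DFunLike.congr_fun e2 q
    simp at e1' e2' ⊢
    rw [← mul_assoc, ← e1', ← e2', one_mul]

theorem norm_Lp_rpow {α : Type*} [MeasurableSpace α] {μ : Measure α} {p : ℝ≥0∞} [Fact (1 ≤ p)]
    (hp' : p ≠ ∞) (f : Lp ℝ p μ) : ‖f‖ ^ p.toReal = ∫ a, |f a| ^ p.toReal ∂μ := by
  have hp0 : p ≠ 0 := (zero_lt_one.trans_le Fact.out).ne'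
  have hpp : 0 < p.toReal := ENNReal.toReal_pos hp0 hp'
  rw [Lp.norm_def, (Lp.memLp f).eLpNorm_eq_integral_rpow_norm hp0 hp',
    ENNReal.toReal_ofReal (by positivity), ← Real.rpow_mul (by positivity),
    inv_mul_cancel₀ hpp.ne', Real.rpow_one]
  rfl

theorem exists_rep {G Q : Type*} [Group G] [TopologicalSpace Q] [CompactSpace Q] [T2Space Q]
    [SecondCountableTopology Q] [MeasurableSpace Q] [BorelSpace Q]
    (m : Measure Q) [m.Regular] [IsFiniteMeasure m] (p : ℝ≥0∞) [Fact (1 ≤ p)] (hp' : p ≠ ∞)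
    (y : G → C(Q, ℝ)) (θ : G → C(Q, Q)) (h1 : y 1 = 1) (h2 : θ 1 = ContinuousMap.id Q)
    (h3 : ∀ h k, y (h * k) = y h * (y k).comp (θ h))
    (h4 : ∀ h k, θ (h * k) = (θ k).comp (θ h))
    (x : G → C(Q, ℝ)) (h5 : ∀ h k, x (h * k) = y h * (x k).comp (θ h) + x h)
    (h6 : ∀ (g : G) (F : C(Q, ℝ)), ∫ q, |y g q * F (θ g q)| ^ p.toReal ∂m
      = ∫ q, |F q| ^ p.toReal ∂m) :
    ∃ (π : G → (Lp ℝ p m ≃ₗᵢ[ℝ] Lp ℝ p m)) (b : G → Lp ℝ p m),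
      (∀ g h : G, ∀ v, π (g * h) v = π g (π h v)) ∧
      (∀ g h : G, b (g * h) = π g (b h) + b g) ∧
      ∀ g, ‖b g‖ ^ p.toReal = ∫ q, |x g q| ^ p.toReal ∂m := by
  have hp0 : p ≠ 0 := (zero_lt_one.trans_le Fact.out).ne'
  have hpp : 0 < p.toReal := ENNReal.toReal_pos hp0 hp'
  let e : C(Q, ℝ) →ₗ[ℝ] Lp ℝ p m := (ContinuousMap.toLp p m ℝ : C(Q, ℝ) →L[ℝ] Lp ℝ p m)
  have hd : DenseRange e := ContinuousMap.toLp_denseRange ℝ m ℝ hp'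
  have hn : ∀ F : C(Q, ℝ), ‖e F‖ ^ p.toReal = ∫ q, |F q| ^ p.toReal ∂m := by
    intro F
    rw [norm_Lp_rpow hp']
    apply integral_congr_ae
    filter_upwards [ContinuousMap.coeFn_toLp (p := p) (𝕜 := ℝ) m F] with q hq
    show |(ContinuousMap.toLp p m ℝ F) q| ^ _ = _
    rw [hq]
  let U := wcomp y θ h1 h2 h3 h4
  have hU : ∀ g F, ‖e (U g F)‖ = ‖e F‖ := by
    intro g F
    have := (hn (U g F)).trans ((h6 g F).trans (hn F).symm)
    exact (Real.rpow_left_inj (norm_nonneg _) (norm_nonneg _) hpp.ne').1 this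
  let P := fun g => (U g).extendOfIsometry e e hd hd (hU g)
  have hP : ∀ g F, P g (e F) = e (U g F) := fun g F =>
    (U g).extendOfIsometry_eq e e hd hd (hU g) F
  refine ⟨P, fun g => e (x g), ?_, ?_, fun g => hn (x g)⟩
  · intro g h
    refine hd.induction ?_ (isClosed_eq (P _).continuous ((P g).continuous.comp (P h).continuous))
    rintro _ ⟨F, rfl⟩
    rw [hP, hP, hP]
    congr 1
    ext q
    show y (g * h) q * F (θ (g * h) q) = y g q * (y h (θ g q) * F (θ h (θ g q)))
    rw [h3, h4]
    simp [mul_assoc]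
  · intro g h
    rw [hP, ← map_add]
    exact congrArg e (h5 g h)

/-- Riesz representation of a positive functional on a compact space. -/
theorem exists_measure {Q : Type*} [TopologicalSpace Q] [CompactSpace Q] [T2Space Q]
    [MeasurableSpace Q] [BorelSpace Q] (Λ : C(Q, ℝ) →ₗ[ℝ] ℝ) (hΛ : ∀ F, 0 ≤ F → 0 ≤ Λ F) :
    ∃ m : Measure Q, m.Regular ∧ IsFiniteMeasure m ∧ ∀ F : C(Q, ℝ), ∫ q, F q ∂m = Λ F := by
  let Λ₁ : CompactlySupportedContinuousMap Q ℝ →ₗ[ℝ] ℝ :=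
    { toFun := fun F => Λ F.toContinuousMap
      map_add' := fun F F' => Λ.map_add _ _
      map_smul' := fun c F => Λ.map_smul c _ }
  let Λ' := PositiveLinearMap.mk₀ Λ₁ (fun F hF => hΛ _ hF)
  refine ⟨RealRMK.rieszMeasure Λ', by infer_instance, by infer_instance, fun F => ?_⟩
  exact RealRMK.integral_rieszMeasure Λ' ⟨F, HasCompactSupport.of_compactSpace _⟩

/-- Ultralimit of positive functionals. -/
theorem exists_limit {Q : Type*} [TopologicalSpace Q] [CompactSpace Q]
    (Λ : ℕ → C(Q, ℝ) →ₗ[ℝ] ℝ) (hΛ : ∀ i F, 0 ≤ F → 0 ≤ Λ i F) (M : ℝ) (hM : ∀ i, Λ i 1 ≤ M) :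
    ∃ L : C(Q, ℝ) →ₗ[ℝ] ℝ, (∀ F, 0 ≤ F → 0 ≤ L F) ∧
      ∀ F, Tendsto (fun i => Λ i F) (hyperfilter ℕ) (𝓝 (L F)) := by
  have hb : ∀ F i, Λ i F ∈ Set.Icc (-(‖F‖ * M)) (‖F‖ * M) := by
    intro F i
    have hle : ∀ F' : C(Q, ℝ), Λ i F' ≤ ‖F'‖ * M := by
      intro F'
      have h0 : 0 ≤ ‖F'‖ • (1 : C(Q, ℝ)) - F' := by
        intro q
        have := (le_abs_self _).trans (F'.norm_coe_le_norm q)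
        simpa using this
      have := hΛ i _ h0
      rw [map_sub, map_smul, smul_eq_mul] at this
      have h2 := mul_le_mul_of_nonneg_left (hM i) (norm_nonneg F')
      linarith
    constructor
    · have := hle (-F)
      rw [map_neg, norm_neg] at this
      linarith
    · exact hle F
  have hl : ∀ F, ∃ l, Tendsto (fun i => Λ i F) (hyperfilter ℕ) (𝓝 l) := by
    intro F
    obtain ⟨l, _, hl⟩ := isCompact_Icc.ultrafilter_le_nhds
      ((hyperfilter ℕ).map (fun i => Λ i F))
      (le_principal_iff.2 (Filter.mem_map.2 (Filter.univ_mem' (hb F))))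
    exact ⟨l, hl⟩
  choose L hL using hl
  refine ⟨{ toFun := L, map_add' := ?_, map_smul' := ?_ }, ?_, hL⟩
  · intro F F'
    refine tendsto_nhds_unique (hL _) ?_
    simpa using (hL F).add (hL F')
  · intro c F
    refine tendsto_nhds_unique (hL _) ?_
    simpa using (hL F).const_mul c
  · intro F hF
    exact ge_of_tendsto' (hL F) (fun i => hΛ i F hF)

/-- The compact space of normalised cocycles. -/
def QSet {G : Type*} [Group G] (C : G → ℝ) : Set ((G → ℝ) × (G → ℝ)) :=
  {z | z.1 1 = 0 ∧ z.2 1 = 1 ∧ (∀ h k, z.2 (h * k) ≤ C k * z.2 h) ∧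
    ∀ h g, |z.1 (h * g) - z.1 h| ≤ C g * z.2 h}

section Q

variable {G : Type*} [Group G] {C : G → ℝ}

theorem QSet_pos (hC : ∀ g, 0 < C g) {z : (G → ℝ) × (G → ℝ)} (hz : z ∈ QSet C) (h : G) :
    0 < z.2 h := by
  obtain ⟨-, h1, h2, -⟩ := hz
  have := h2 h h⁻¹
  rw [mul_inv_cancel, h1] at this
  exact pos_of_mul_pos_right (zero_lt_one.trans_le this) (hC _).le

theorem QSet_compact (hC : ∀ g, 0 < C g) : IsCompact (QSet C) := by
  have hK : IsCompact ((Set.univ.pi fun g => Set.Icc (-C g) (C g)) ×ˢ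
      (Set.univ.pi fun g => Set.Icc 0 (C g)) : Set ((G → ℝ) × (G → ℝ))) :=
    (isCompact_univ_pi fun g => isCompact_Icc).prod (isCompact_univ_pi fun g => isCompact_Icc)
  refine hK.of_isClosed_subset ?_ ?_
  · have : QSet C = {z : (G → ℝ) × (G → ℝ) | z.1 1 = 0} ∩ ({z | z.2 1 = 1} ∩
        ((⋂ h, ⋂ k, {z | z.2 (h * k) ≤ C k * z.2 h}) ∩
        (⋂ h, ⋂ g, {z | |z.1 (h * g) - z.1 h| ≤ C g * z.2 h}))) := by
      ext z; simp [QSet]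
    rw [this]
    refine (isClosed_eq (by fun_prop) (by fun_prop)).inter
      ((isClosed_eq (by fun_prop) (by fun_prop)).inter (IsClosed.inter ?_ ?_))
    · exact isClosed_iInter fun h => isClosed_iInter fun k =>
        isClosed_le (by fun_prop) (by fun_prop)
    · exact isClosed_iInter fun h => isClosed_iInter fun k =>
        isClosed_le (by fun_prop) (by fun_prop)
  · intro z hz
    have hpos := QSet_pos hC hz
    obtain ⟨h0, h1, h2, h3⟩ := hz
    refine ⟨fun g _ => ?_, fun g _ => ?_⟩
    · have := h3 1 g
      rw [one_mul, h0, h1, sub_zero, mul_one] at this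
      exact abs_le.1 this
    · have := h2 1 g
      rw [one_mul, h1, mul_one] at this
      exact ⟨(hpos g).le, this⟩

/-- The `y` coordinates. -/
def Qy (C : G → ℝ) (h : G) : C(QSet C, ℝ) := ⟨fun q => q.1.2 h, by fun_prop⟩

/-- The `x` coordinates. -/
def Qx (C : G → ℝ) (h : G) : C(QSet C, ℝ) := ⟨fun q => q.1.1 h, by fun_prop⟩

/-- The action on `QSet`. -/
noncomputable def Qθ (hC : ∀ g, 0 < C g) (h : G) : C(QSet C, QSet C) where
  toFun q := ⟨(fun g => (q.1.1 (h * g) - q.1.1 h) / q.1.2 h, fun k => q.1.2 (h * k) / q.1.2 h), by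
    have hpos := QSet_pos hC q.2
    obtain ⟨h0, h1, h2, h3⟩ := q.2
    refine ⟨?_, ?_, ?_, ?_⟩
    · simp
    · simp [(hpos h).ne']
    · intro k l
      have := h2 (h * k) l
      simp only
      rw [← mul_div_assoc, ← mul_assoc]
      exact div_le_div_of_nonneg_right this (hpos h).le
    · intro k g
      have := h3 (h * k) g
      simp only
      rw [← mul_div_assoc, ← mul_assoc, ← sub_div, abs_div, abs_of_pos (hpos h),
        sub_sub_sub_cancel_right]
      exact div_le_div_of_nonneg_right this (hpos h).le⟩
  continuous_toFun := by
    refine Continuous.subtype_mk (Continuous.prodMk ?_ ?_) _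
    · refine continuous_pi fun g => Continuous.div (by fun_prop) (by fun_prop) ?_
      exact fun q => (QSet_pos hC q.2 h).ne'
    · refine continuous_pi fun g => Continuous.div (by fun_prop) (by fun_prop) ?_
      exact fun q => (QSet_pos hC q.2 h).ne'

theorem Qy_one : Qy C 1 = 1 := by
  ext q; exact q.2.2.1

theorem Qθ_one (hC : ∀ g, 0 < C g) : Qθ hC 1 = ContinuousMap.id _ := by
  ext q
  · have h0 := q.2.1
    have h1 := q.2.2.1
    simp [Qθ, h0, h1]
  · have h1 := q.2.2.1
    simp [Qθ, h1]

theorem Qy_mul (hC : ∀ g, 0 < C g) (h k : G) : Qy C (h * k) = Qy C h * (Qy C k).comp (Qθ hC h) := by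
  ext q
  have := (QSet_pos hC q.2 h).ne'
  simp [Qy, Qθ]
  field_simp

theorem Qθ_mul (hC : ∀ g, 0 < C g) (h k : G) : Qθ hC (h * k) = (Qθ hC k).comp (Qθ hC h) := by
  ext q g
  · have h1 := (QSet_pos hC q.2 h).ne'
    have h2 := (QSet_pos hC q.2 (h * k)).ne'
    simp [Qθ]
    field_simp
    simp [mul_assoc]
  · have h1 := (QSet_pos hC q.2 h).ne'
    have h2 := (QSet_pos hC q.2 (h * k)).ne'
    simp [Qθ]
    field_simp
    simp [mul_assoc]

theorem Qx_mul (hC : ∀ g, 0 < C g) (h k : G) :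
    Qx C (h * k) = Qy C h * (Qx C k).comp (Qθ hC h) + Qx C h := by
  ext q
  have := (QSet_pos hC q.2 h).ne'
  simp [Qx, Qy, Qθ]
  field_simp
  ring

end Q

/-- Abstract construction from functionals on `QSet`. -/
theorem core_of_functionals {G : Type} [Group G] [Countable G] (C : G → ℝ) (hC : ∀ g, 0 < C g)
    (p : ℝ≥0∞) [Fact (1 ≤ p)] (hp' : p ≠ ∞)
    (Λ : ℕ → C(QSet C, ℝ) →ₗ[ℝ] ℝ) (hΛ : ∀ i F, 0 ≤ F → 0 ≤ Λ i F)
    (M : ℝ) (hM : ∀ i, Λ i 1 ≤ M)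
    (hinv : ∀ i g (F F' : C(QSet C, ℝ)),
      (∀ q, F' q = |Qy C g q| ^ p.toReal * F (Qθ hC g q)) → Λ i F' = Λ i F)
    (hprop : ∀ A : ℝ, 0 ≤ A → ∀ᶠ g in cofinite, ∀ᶠ i in atTop, ∀ F : C(QSet C, ℝ),
      (∀ q, F q = |Qx C g q| ^ p.toReal) → A ^ p.toReal ≤ Λ i F) :
    ∃ (α : Type) (_ : MeasurableSpace α) (μ : MeasureTheory.Measure α)
    (π : G → (MeasureTheory.Lp ℝ p μ ≃ₗᵢ[ℝ] MeasureTheory.Lp ℝ p μ))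
    (b : G → MeasureTheory.Lp ℝ p μ),
    (∀ g h : G, ∀ v, π (g * h) v = π g (π h v)) ∧
    (∀ g h : G, b (g * h) = π g (b h) + b g) ∧
    Filter.Tendsto (fun g : G => ‖b g‖) Filter.cofinite Filter.atTop := by
  have hp0 : p ≠ 0 := (zero_lt_one.trans_le Fact.out).ne'
  have hpp : 0 < p.toReal := ENNReal.toReal_pos hp0 hp'
  have : CompactSpace (QSet C) := isCompact_iff_compactSpace.1 (QSet_compact hC)
  obtain ⟨L, hL0, hL⟩ := exists_limit Λ hΛ M hM
  obtain ⟨m, hm1, hm2, hm⟩ := exists_measure L hL0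
  let pw : C(QSet C, ℝ) → C(QSet C, ℝ) := fun F =>
    ⟨fun q => |F q| ^ p.toReal, F.continuous.abs.rpow_const fun _ => Or.inr hpp.le⟩
  obtain ⟨π, b, h1, h2, h3⟩ := exists_rep m p hp' (Qy C) (Qθ hC) Qy_one (Qθ_one hC) (Qy_mul hC)
    (Qθ_mul hC) (Qx C) (Qx_mul hC) (by
      intro g F
      have e1 := hm (pw (Qy C g * F.comp (Qθ hC g)))
      have e2 := hm (pw F)
      have e3 : L (pw (Qy C g * F.comp (Qθ hC g))) = L (pw F) := by
        refine tendsto_nhds_unique (hL _) ((hL (pw F)).congr fun i => ?_)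
        refine (hinv i g _ _ fun q => ?_).symm
        simp [pw, abs_mul, Real.mul_rpow]
      exact e1.trans (e3.trans e2.symm))
  refine ⟨QSet C, inferInstance, m, π, b, h1, h2, ?_⟩
  rw [tendsto_atTop]
  intro A
  filter_upwards [hprop (max A 0) (le_max_right _ _)] with g hg
  have h4 : (max A 0) ^ p.toReal ≤ ‖b g‖ ^ p.toReal := by
    rw [h3 g]
    refine le_of_le_of_eq ?_ (hm (pw (Qx C g))).symm
    refine ge_of_tendsto (hL _) ?_
    have : ∀ᶠ i in (hyperfilter ℕ : Filter ℕ), ∀ F : C(QSet C, ℝ),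
      (∀ q, F q = |Qx C g q| ^ p.toReal) → (max A 0) ^ p.toReal ≤ Λ i F := by
      refine Filter.Eventually.filter_mono ?_ hg
      rw [← Nat.cofinite_eq_atTop]
      exact hyperfilter_le_cofinite
    filter_upwards [this] with i hi
    exact hi _ fun q => rfl
  exact (le_max_left _ _).trans
    ((Real.rpow_le_rpow_iff (le_max_right _ _) (norm_nonneg _) hpp).1 h4)

section Fin

variable {G F α : Type*} [Group G] [Group F] [Fintype F] (φ : G →* F) (u : F → α → ℝ) (w : G → ℝ)

/-- The cocycle of increments. -/
def BB (g : G) (x : F) (a : α) : ℝ := u (x * φ g) a - u x a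

/-- The normalising function. -/
noncomputable def WW (x : F) (a : α) : ℝ := ⨆ g, w g * |BB φ u g x a|

theorem BB_mul (h g : G) (x : F) (a : α) :
    BB φ u g (x * φ h) a = BB φ u (h * g) x a - BB φ u h x a := by
  simp [BB, mul_assoc]

theorem BB_one (x : F) (a : α) : BB φ u 1 x a = 0 := by simp [BB]

variable {w}

theorem WW_bdd (hw1 : ∀ g, w g ≤ 1)
    (x : F) (a : α) : BddAbove (Set.range fun g => w g * |BB φ u g x a|) := by
  refine ⟨∑ z, |u z a - u x a|, ?_⟩
  rintro _ ⟨g, rfl⟩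
  calc w g * |BB φ u g x a| ≤ 1 * |BB φ u g x a| :=
        mul_le_mul_of_nonneg_right (hw1 g) (abs_nonneg _)
    _ = |u (x * φ g) a - u x a| := one_mul _
    _ ≤ _ := Finset.single_le_sum (f := fun z => |u z a - u x a|) (fun _ _ => abs_nonneg _)
        (Finset.mem_univ _)

theorem le_WW (hw1 : ∀ g, w g ≤ 1)
    (g : G) (x : F) (a : α) : w g * |BB φ u g x a| ≤ WW φ u w x a :=
  le_ciSup (WW_bdd φ u hw1 x a) g

theorem WW_nonneg (hw1 : ∀ g, w g ≤ 1)
    (x : F) (a : α) : 0 ≤ WW φ u w x a := by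
  have := le_WW φ u hw1 1 x a
  simpa [BB_one] using this

theorem BB_le (hw0 : ∀ g, 0 < w g) (hw1 : ∀ g, w g ≤ 1)
    (g : G) (x : F) (a : α) : |BB φ u g x a| ≤ (w g)⁻¹ * WW φ u w x a := by
  rw [le_inv_mul_iff₀ (hw0 g)]
  exact le_WW φ u hw1 g x a

theorem WW_mul (hw0 : ∀ g, 0 < w g) (hw1 : ∀ g, w g ≤ 1)
    {D : G → ℝ} (hD : ∀ h g, w g ≤ D h * w (h * g)) (h : G) (x : F) (a : α) :
    WW φ u w (x * φ h) a ≤ (D h + (w h)⁻¹) * WW φ u w x a := by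
  have hDpos : 0 ≤ D h :=
    (pos_of_mul_pos_left ((hw0 1).trans_le (hD h 1)) (hw0 _).le).le
  refine ciSup_le fun g => ?_
  rw [BB_mul]
  have h1 := abs_sub (BB φ u (h * g) x a) (BB φ u h x a)
  have h2 := le_WW φ u hw1 (h * g) x a
  have h3 := BB_le φ u hw0 hw1 h x a
  calc w g * |BB φ u (h * g) x a - BB φ u h x a|
      ≤ w g * (|BB φ u (h * g) x a| + |BB φ u h x a|) :=
        mul_le_mul_of_nonneg_left h1 (hw0 g).le
    _ = w g * |BB φ u (h * g) x a| + w g * |BB φ u h x a| := mul_add _ _ _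
    _ ≤ D h * w (h * g) * |BB φ u (h * g) x a| + 1 * |BB φ u h x a| :=
        add_le_add (mul_le_mul_of_nonneg_right (hD h g) (abs_nonneg _))
          (mul_le_mul_of_nonneg_right (hw1 g) (abs_nonneg _))
    _ ≤ D h * WW φ u w x a + (w h)⁻¹ * WW φ u w x a := by
        rw [mul_assoc, one_mul]
        exact add_le_add (mul_le_mul_of_nonneg_left h2 hDpos) h3
    _ = _ := (add_mul _ _ _).symm

/-- The map to `QSet`. -/
noncomputable def qq {C : G → ℝ} (hC : ∀ g, 1 ≤ C g)
    (hB : ∀ g x a, |BB φ u g x a| ≤ C g * WW φ u w x a)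
    (hW : ∀ h x a, WW φ u w (x * φ h) a ≤ C h * WW φ u w x a)
    (hW0 : ∀ x a, 0 ≤ WW φ u w x a) (x : F) (a : α) : QSet C :=
  ⟨(fun g => BB φ u g x a / WW φ u w x a,
    fun h => if WW φ u w x a = 0 then 1 else WW φ u w (x * φ h) a / WW φ u w x a), by
    by_cases h0 : WW φ u w x a = 0
    · refine ⟨?_, ?_, ?_, ?_⟩
      · simp [h0]
      · simp [h0]
      · intro h k; simpa [h0] using hC k
      · intro h k; simpa [h0] using zero_le_one.trans (hC k)
    · have hpos := lt_of_le_of_ne (hW0 x a) (Ne.symm h0)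
      refine ⟨?_, ?_, ?_, ?_⟩
      · simp [BB_one]
      · simp [h0]
      · intro h k
        simp only [h0, if_false]
        rw [← mul_div_assoc, map_mul, ← mul_assoc]
        exact div_le_div_of_nonneg_right (hW k _ a) hpos.le
      · intro h g
        simp only [h0, if_false]
        rw [← mul_div_assoc, ← sub_div, abs_div, abs_of_pos hpos, ← BB_mul]
        exact div_le_div_of_nonneg_right (hB g _ a) hpos.le⟩

end Fin

theorem integral_WW {G F α : Type*} [Group G] [Countable G] [Group F] [Fintype F] (φ : G →* F)
    [MeasurableSpace α] {μ : Measure α} (u : F → α → ℝ) (hu : ∀ x, Measurable (u x))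
    {w : G → ℝ} (hw0 : ∀ g, 0 < w g) (hw1 : ∀ g, w g ≤ 1) {P : ℝ} (hP : 0 < P)
    (hint : ∀ x z, Integrable (fun a => |u z a - u x a| ^ P) μ)
    {R : G → ℝ} (hR0 : ∀ g, 0 ≤ R g)
    (hR : ∀ g x, ∫ a, |BB φ u g x a| ^ P ∂μ ≤ R g ^ P)
    (hsum : Summable fun g => (w g * R g) ^ P) (x : F) :
    Integrable (fun a => WW φ u w x a ^ P) μ ∧
      ∫ a, WW φ u w x a ^ P ∂μ ≤ ∑' g, (w g * R g) ^ P := by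
  have hBm : ∀ g, Measurable (fun a => BB φ u g x a) := fun g => (hu _).sub (hu _)
  have hWm : Measurable (fun a => WW φ u w x a) :=
    Measurable.iSup fun g => ((hBm g).abs.const_mul _)
  have hW0 := WW_nonneg φ u hw1
  have hpt : ∀ a, ENNReal.ofReal (WW φ u w x a ^ P) ≤
      ∑' g, ENNReal.ofReal ((w g * |BB φ u g x a|) ^ P) := by
    intro a
    by_cases hT : ∑' g, ENNReal.ofReal ((w g * |BB φ u g x a|) ^ P) = ⊤
    · rw [hT]; exact le_top
    · rw [ENNReal.ofReal_le_iff_le_toReal hT]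
      set T := ∑' g, ENNReal.ofReal ((w g * |BB φ u g x a|) ^ P)
      have h1 : WW φ u w x a ≤ T.toReal ^ P⁻¹ := by
        refine ciSup_le fun g => ?_
        have hnn : 0 ≤ w g * |BB φ u g x a| := mul_nonneg (hw0 g).le (abs_nonneg _)
        rw [Real.le_rpow_inv_iff_of_pos hnn ENNReal.toReal_nonneg hP]
        rw [← ENNReal.ofReal_le_iff_le_toReal hT]
        exact ENNReal.le_tsum g
      rwa [Real.le_rpow_inv_iff_of_pos (hW0 x a) ENNReal.toReal_nonneg hP] at h1
  have hl : ∫⁻ a, ENNReal.ofReal (WW φ u w x a ^ P) ∂μ ≤ ENNReal.ofReal (∑' g, (w g * R g) ^ P) := by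
    calc ∫⁻ a, ENNReal.ofReal (WW φ u w x a ^ P) ∂μ
        ≤ ∫⁻ a, ∑' g, ENNReal.ofReal ((w g * |BB φ u g x a|) ^ P) ∂μ := lintegral_mono hpt
      _ = ∑' g, ∫⁻ a, ENNReal.ofReal ((w g * |BB φ u g x a|) ^ P) ∂μ := by
          refine lintegral_tsum fun g => ?_
          exact ((((hBm g).abs.const_mul _).pow_const P).ennreal_ofReal).aemeasurable
      _ ≤ ∑' g, ENNReal.ofReal ((w g * R g) ^ P) := by
          refine ENNReal.tsum_le_tsum fun g => ?_
          have e : ∀ a, (w g * |BB φ u g x a|) ^ P = w g ^ P * |BB φ u g x a| ^ P := fun a =>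
            Real.mul_rpow (hw0 g).le (abs_nonneg _)
          simp_rw [e]
          rw [← ofReal_integral_eq_lintegral_ofReal
            (show Integrable (fun a => w g ^ P * |BB φ u g x a| ^ P) μ from
              (hint x (x * φ g)).const_mul _)
            (Eventually.of_forall fun a => by
              have := (hw0 g).le
              positivity), integral_const_mul, Real.mul_rpow (hw0 g).le (hR0 g)]
          exact ENNReal.ofReal_le_ofReal (mul_le_mul_of_nonneg_left (hR g x)
            (Real.rpow_nonneg (hw0 g).le _))
      _ = _ := (ENNReal.ofReal_tsum_of_nonneg (fun g =>
          Real.rpow_nonneg (mul_nonneg (hw0 g).le (hR0 g)) _) hsum).symm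
  have hnn : 0 ≤ ∑' g, (w g * R g) ^ P := tsum_nonneg fun g =>
    Real.rpow_nonneg (mul_nonneg (hw0 g).le (hR0 g)) _
  have hI : Integrable (fun a => WW φ u w x a ^ P) μ := by
    refine ⟨(hWm.pow_const P).aestronglyMeasurable, ?_⟩
    rw [hasFiniteIntegral_iff_ofReal (Eventually.of_forall fun a => Real.rpow_nonneg (hW0 x a) _)]
    exact hl.trans_lt ENNReal.ofReal_lt_top
  refine ⟨hI, ?_⟩
  rw [← ofReal_integral_eq_lintegral_ofReal hI
    (Eventually.of_forall fun a => Real.rpow_nonneg (hW0 x a) _)] at hl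
  exact (ENNReal.ofReal_le_ofReal_iff hnn).1 hl

theorem exists_functional {G F α : Type*} [Group G] [Countable G] [Group F] [Fintype F]
    (φ : G →* F) [MeasurableSpace α] {μ : Measure α} (p : ℝ≥0∞) [Fact (1 ≤ p)] (hp' : p ≠ ∞)
    (f : F → Lp ℝ p μ)
    {w : G → ℝ} (hw0 : ∀ g, 0 < w g) (hw1 : ∀ g, w g ≤ 1)
    {D : G → ℝ} (hD : ∀ h g, w g ≤ D h * w (h * g))
    {R : G → ℝ} (hR : ∀ g x, ‖f (x * φ g) - f x‖ ≤ R g)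
    (hsum : Summable fun g => (w g * R g) ^ p.toReal)
    {C : G → ℝ} (hCD : ∀ g, C g = D g + (w g)⁻¹) (hC : ∀ g, 0 < C g) :
    ∃ Λ : C(QSet C, ℝ) →ₗ[ℝ] ℝ, (∀ Φ, 0 ≤ Φ → 0 ≤ Λ Φ) ∧
      Λ 1 ≤ ∑' g, (w g * R g) ^ p.toReal ∧
      (∀ g (Φ Φ' : C(QSet C, ℝ)),
        (∀ q, Φ' q = |Qy C g q| ^ p.toReal * Φ (Qθ hC g q)) → Λ Φ' = Λ Φ) ∧
      ∀ g A, 0 ≤ A → (∀ x, A ≤ ‖f (x * φ g) - f x‖) → ∀ Φ : C(QSet C, ℝ),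
        (∀ q, Φ q = |Qx C g q| ^ p.toReal) → A ^ p.toReal ≤ Λ Φ := by
  have hp0 : p ≠ 0 := (zero_lt_one.trans_le Fact.out).ne'
  have hpp : 0 < p.toReal := ENNReal.toReal_pos hp0 hp'
  set P := p.toReal with hPdef
  have : CompactSpace (QSet C) := isCompact_iff_compactSpace.1 (QSet_compact hC)
  let u : F → α → ℝ := fun x => f x
  have hu : ∀ x, Measurable (u x) := fun x => (Lp.stronglyMeasurable (f x)).measurable
  have hDpos : ∀ h, 0 ≤ D h := fun h =>
    (pos_of_mul_pos_left ((hw0 1).trans_le (hD h 1)) (hw0 _).le).le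
  have hnorm : ∀ x z, ‖f z - f x‖ ^ P = ∫ a, |u z a - u x a| ^ P ∂μ := by
    intro x z
    rw [norm_Lp_rpow hp']
    refine integral_congr_ae ?_
    filter_upwards [Lp.coeFn_sub (f z) (f x)] with a ha
    rw [ha]; rfl
  have hint : ∀ x z, Integrable (fun a => |u z a - u x a| ^ P) μ := by
    intro x z
    exact ((Lp.memLp (f z)).sub (Lp.memLp (f x))).integrable_norm_rpow hp0 hp'
  have hR0 : ∀ g, 0 ≤ R g := fun g => (norm_nonneg _).trans (hR g 1)
  have hRI : ∀ g x, ∫ a, |BB φ u g x a| ^ P ∂μ ≤ R g ^ P := by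
    intro g x
    refine le_of_eq_of_le (hnorm x (x * φ g)).symm ?_
    exact Real.rpow_le_rpow (norm_nonneg _) (hR g x) hpp.le
  have hWI := integral_WW φ u hu hw0 hw1 hpp hint hR0 hRI hsum
  have hW0 := WW_nonneg φ u hw1
  have hCw : ∀ g, (w g)⁻¹ ≤ C g := fun g => by rw [hCD]; linarith [hDpos g]
  have hC1 : ∀ g, 1 ≤ C g := fun g => ((one_le_inv₀ (hw0 g)).2 (hw1 g)).trans (hCw g)
  have hB : ∀ g x a, |BB φ u g x a| ≤ C g * WW φ u w x a := fun g x a =>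
    (BB_le φ u hw0 hw1 g x a).trans (mul_le_mul_of_nonneg_right (hCw g) (hW0 x a))
  have hWC : ∀ h x a, WW φ u w (x * φ h) a ≤ C h * WW φ u w x a := fun h x a => by
    rw [hCD]; exact WW_mul φ u hw0 hw1 hD h x a
  have hBm : ∀ g x, Measurable (fun a => BB φ u g x a) := fun g x => (hu _).sub (hu _)
  have hWm : ∀ x, Measurable (fun a => WW φ u w x a) := fun x =>
    Measurable.iSup fun g => ((hBm g x).abs.const_mul _)
  let q := qq φ u hC1 hB hWC hW0
  have hqm : ∀ x, Measurable (q x) := by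
    intro x
    refine Measurable.subtype_mk (Measurable.prodMk ?_ ?_)
    · exact measurable_pi_lambda _ fun g => (hBm g x).div (hWm x)
    · refine measurable_pi_lambda _ fun h => Measurable.ite ?_ measurable_const
        ((hWm _).div (hWm x))
      exact hWm x (measurableSet_singleton 0)
  have hI : ∀ x (Φ : C(QSet C, ℝ)), Integrable (fun a => WW φ u w x a ^ P * Φ (q x a)) μ := by
    intro x Φ
    refine (hWI x).1.mul_bdd (c := ‖Φ‖) ?_ (Eventually.of_forall fun a => Φ.norm_coe_le_norm _)
    exact (Φ.continuous.measurable.comp (hqm x)).aestronglyMeasurable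
  have hcard : (0 : ℝ) < Fintype.card F := by exact_mod_cast Fintype.card_pos
  let Λ : C(QSet C, ℝ) →ₗ[ℝ] ℝ :=
    { toFun := fun Φ => (Fintype.card F : ℝ)⁻¹ * ∑ x, ∫ a, WW φ u w x a ^ P * Φ (q x a) ∂μ
      map_add' := by
        intro Φ Φ'
        rw [← mul_add, ← Finset.sum_add_distrib]
        congr 1
        refine Finset.sum_congr rfl fun x _ => ?_
        rw [← integral_add (hI x Φ) (hI x Φ')]
        simp [mul_add]
      map_smul' := by
        intro c Φ
        simp only [RingHom.id_apply, smul_eq_mul]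
        rw [mul_left_comm]
        refine congrArg _ ?_
        rw [Finset.mul_sum]
        refine Finset.sum_congr rfl fun x _ => ?_
        rw [← integral_const_mul]
        congr 1; ext a; simp; ring }
  have hΛ : ∀ Φ, Λ Φ = (Fintype.card F : ℝ)⁻¹ * ∑ x, ∫ a, WW φ u w x a ^ P * Φ (q x a) ∂μ :=
    fun _ => rfl
  refine ⟨Λ, ?_, ?_, ?_, ?_⟩
  · intro Φ hΦ
    rw [hΛ]
    refine mul_nonneg (inv_nonneg.2 hcard.le) (Finset.sum_nonneg fun x _ => ?_)
    exact integral_nonneg fun a => mul_nonneg (Real.rpow_nonneg (hW0 x a) _) (hΦ _)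
  · rw [hΛ, inv_mul_le_iff₀ hcard]
    refine (Finset.sum_le_card_nsmul _ _ (∑' g, (w g * R g) ^ P) fun x _ => ?_).trans_eq ?_
    · simpa using (hWI x).2
    · simp
  · intro h Φ Φ' hΦ
    rw [hΛ, hΛ]
    congr 1
    rw [← Equiv.sum_comp (Equiv.mulRight (φ h))
      (fun x => ∫ a, WW φ u w x a ^ P * Φ (q x a) ∂μ)]
    refine Finset.sum_congr rfl fun x _ => ?_
    congr 1
    ext a
    rw [hΦ, Equiv.coe_mulRight]
    by_cases h0 : WW φ u w x a = 0
    · have h0' : WW φ u w (x * φ h) a = 0 :=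
        le_antisymm (by simpa [h0] using hWC h x a) (hW0 _ _)
      rw [h0, h0', Real.zero_rpow hpp.ne', zero_mul, zero_mul]
    · have hpos := lt_of_le_of_ne (hW0 x a) (Ne.symm h0)
      have hy : Qy C h (q x a) = WW φ u w (x * φ h) a / WW φ u w x a := by
        show (if WW φ u w x a = 0 then 1 else _) = _
        rw [if_neg h0]
      have hypos : 0 < Qy C h (q x a) := QSet_pos hC (q x a).2 h
      have h0' : WW φ u w (x * φ h) a ≠ 0 := by
        intro hh
        rw [hy, hh, zero_div] at hypos
        exact lt_irrefl _ hypos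
      have hθ : Qθ hC h (q x a) = q (x * φ h) a := by
        refine Subtype.ext (Prod.ext (funext fun g => ?_) (funext fun g => ?_))
        · show (BB φ u (h * g) x a / WW φ u w x a - BB φ u h x a / WW φ u w x a) /
            Qy C h (q x a) = BB φ u g (x * φ h) a / WW φ u w (x * φ h) a
          rw [hy, BB_mul]
          field_simp
        · show (if WW φ u w x a = 0 then 1 else _) / Qy C h (q x a) =
            if WW φ u w (x * φ h) a = 0 then 1 else _
          rw [hy, if_neg h0, if_neg h0', map_mul, mul_assoc]
          field_simp
      rw [hθ, ← mul_assoc, abs_of_pos hypos, ← Real.mul_rpow hpos.le hypos.le, hy,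
        mul_div_cancel₀ _ h0]
  · intro g A hA hAx Φ hΦ
    rw [hΛ, le_inv_mul_iff₀ hcard]
    have : ∀ x, A ^ P ≤ ∫ a, WW φ u w x a ^ P * Φ (q x a) ∂μ := by
      intro x
      have e : ∫ a, WW φ u w x a ^ P * Φ (q x a) ∂μ = ∫ a, |BB φ u g x a| ^ P ∂μ := by
        congr 1
        ext a
        rw [hΦ, ← Real.mul_rpow (hW0 x a) (abs_nonneg _)]
        congr 1
        show WW φ u w x a * |BB φ u g x a / WW φ u w x a| = _
        by_cases h0 : WW φ u w x a = 0
        · have := hB g x a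
          rw [h0, mul_zero] at this
          rw [h0, zero_mul]
          exact le_antisymm (abs_nonneg _) this
        · rw [abs_div, abs_of_nonneg (hW0 x a)]
          field_simp
      rw [e]
      refine le_of_le_of_eq ?_ (hnorm x (x * φ g))
      exact Real.rpow_le_rpow hA (hAx x) hpp.le
    refine le_trans (le_of_eq ?_) (Finset.card_nsmul_le_sum _ _ (A ^ P) fun x _ => this x)
    simp

theorem core {G : Type} [Group G] [Countable G] {F : ℕ → Type*} [∀ i, Group (F i)]
    [∀ i, Fintype (F i)] (φ : ∀ i, G →* F i) {α : Type*} [MeasurableSpace α] {μ : Measure α}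
    (p : ℝ≥0∞) [Fact (1 ≤ p)] (hp' : p ≠ ∞) (f : ∀ i, F i → Lp ℝ p μ)
    {w : G → ℝ} (hw0 : ∀ g, 0 < w g) (hw1 : ∀ g, w g ≤ 1)
    {D : G → ℝ} (hD : ∀ h g, w g ≤ D h * w (h * g))
    {R : G → ℝ} (hR : ∀ i g x, ‖f i (x * φ i g) - f i x‖ ≤ R g)
    (hsum : Summable fun g => (w g * R g) ^ p.toReal)
    (hprop : ∀ A : ℝ, ∀ᶠ g in cofinite, ∀ᶠ i in atTop, ∀ x, A ≤ ‖f i (x * φ i g) - f i x‖) :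
    ∃ (α : Type) (_ : MeasurableSpace α) (μ : MeasureTheory.Measure α)
    (π : G → (MeasureTheory.Lp ℝ p μ ≃ₗᵢ[ℝ] MeasureTheory.Lp ℝ p μ))
    (b : G → MeasureTheory.Lp ℝ p μ),
    (∀ g h : G, ∀ v, π (g * h) v = π g (π h v)) ∧
    (∀ g h : G, b (g * h) = π g (b h) + b g) ∧
    Filter.Tendsto (fun g : G => ‖b g‖) Filter.cofinite Filter.atTop := by
  have hC : ∀ g, 0 < D g + (w g)⁻¹ := fun g =>
    add_pos (pos_of_mul_pos_left ((hw0 1).trans_le (hD g 1)) (hw0 _).le) (inv_pos.2 (hw0 g))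
  have H := fun i => exists_functional (φ i) p hp' (f i) hw0 hw1 hD (hR i) hsum
    (C := fun g => D g + (w g)⁻¹) (fun _ => rfl) hC
  choose Λ h1 h2 h3 h4 using H
  refine core_of_functionals _ hC p hp' Λ h1 _ h2 h3 fun A hA => ?_
  filter_upwards [hprop A] with g hg
  filter_upwards [hg] with i hi
  exact h4 i g A hA hi

theorem summable_list {T : Type*} [Fintype T] {r : ℝ} (hr : 0 < r)
    (hr1 : (Fintype.card T : ℝ) * r < 1) : Summable fun l : List T => r ^ l.length := by
  rw [← (Equiv.sigmaFiberEquiv (List.length : List T → ℕ)).summable_iff]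
  have hfin : ∀ n : ℕ, Fintype {l : List T // l.length = n} := fun n =>
    (inferInstance : Fintype (List.Vector T n))
  rw [summable_sigma_of_nonneg (fun _ => by simp only [Function.comp]; positivity)]
  refine ⟨fun n => ?_, ?_⟩
  · exact (hasSum_fintype _).summable
  · refine (summable_geometric_of_lt_one (by positivity) hr1).congr fun n => ?_
    rw [tsum_fintype]
    have : ∀ l : {l : List T // l.length = n}, (((fun l : List T => r ^ l.length) ∘
        (Equiv.sigmaFiberEquiv (List.length : List T → ℕ))) ⟨n, l⟩) = r ^ n := by
      rintro ⟨l, hl⟩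
      simp [Equiv.sigmaFiberEquiv, hl]
    rw [Finset.sum_congr rfl fun l _ => this l, Finset.sum_const, nsmul_eq_mul, mul_pow]
    congr 1
    have hc' : Fintype.card {l : List T // l.length = n} = Fintype.card T ^ n := by
      rw [← card_vector (α := T) n]; exact Fintype.card_congr (Equiv.refl _)
    rw [Finset.card_univ, hc']
    push_cast
    rfl

theorem word_length {Γ : Type*} [Group Γ] [MetricSpace Γ] {S : Set Γ} (hS : IsWordMetric S) :
    ∃ ℓ : Γ → ℕ, (∀ g h, dist g h = ℓ (g⁻¹ * h)) ∧ (∀ g h, ℓ (g * h) ≤ ℓ g + ℓ h) ∧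
      (∀ g, ∃ l : List Γ, (∀ x ∈ l, ℓ x ≤ 1) ∧ l.prod = g ∧ l.length = ℓ g) ∧
      ∃ r : ℝ, 0 < r ∧ r ≤ 1 ∧ Summable fun g => r ^ ℓ g := by
  obtain ⟨hfin, hgen, hdist⟩ := hS
  have hex : ∀ g : Γ, ∃ n : ℕ, ∃ l : List Γ,
      l.length = n ∧ (∀ x ∈ l, x ∈ S ∨ x⁻¹ ∈ S) ∧ g = l.prod := by
    intro g
    have hg : g ∈ (Subgroup.closure S).toSubmonoid := by rw [hgen]; trivial
    rw [Subgroup.closure_toSubmonoid] at hg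
    obtain ⟨l, hl, hp⟩ := Submonoid.exists_list_of_mem_closure hg
    exact ⟨_, l, rfl, fun x hx => by simpa using hl x hx, hp.symm⟩
  classical
  let ℓ : Γ → ℕ := fun g => Nat.find (hex g)
  have hmin : ∀ l : List Γ, (∀ x ∈ l, x ∈ S ∨ x⁻¹ ∈ S) → ℓ l.prod ≤ l.length := fun l hl =>
    Nat.find_min' _ ⟨l, rfl, hl, rfl⟩
  have hspec : ∀ g, ∃ l : List Γ, l.length = ℓ g ∧ (∀ x ∈ l, x ∈ S ∨ x⁻¹ ∈ S) ∧ g = l.prod :=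
    fun g => Nat.find_spec (hex g)
  choose ω h1 h2 h3 using hspec
  have hlet : ∀ x, (x ∈ S ∨ x⁻¹ ∈ S) → ℓ x ≤ 1 := by
    intro x hx
    have := hmin [x] (by simpa using hx)
    simpa using this
  refine ⟨ℓ, ?_, ?_, ?_, ?_⟩
  · intro g h
    rw [hdist]
    apply le_antisymm
    · refine csInf_le ⟨0, ?_⟩ ⟨ω (g⁻¹ * h), by rw [h1], h2 _, h3 _⟩
      rintro t ⟨l, rfl, -⟩
      positivity
    · refine le_csInf ⟨_, ω (g⁻¹ * h), rfl, h2 _, h3 _⟩ ?_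
      rintro t ⟨l, rfl, hl, hp⟩
      rw [hp]
      exact_mod_cast hmin l hl
  · intro g h
    have := hmin (ω g ++ ω h) (by
      intro x hx
      rcases List.mem_append.1 hx with hx | hx
      · exact h2 g x hx
      · exact h2 h x hx)
    rwa [List.prod_append, List.length_append, ← h3, ← h3, h1, h1] at this
  · exact fun g => ⟨ω g, fun x hx => hlet x (h2 g x hx), (h3 g).symm, h1 g⟩
  · have hTfin : {x : Γ | x ∈ S ∨ x⁻¹ ∈ S}.Finite := by
      have : {x : Γ | x ∈ S ∨ x⁻¹ ∈ S} = S ∪ S⁻¹ := by ext; simp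
      rw [this]
      exact hfin.union hfin.inv
    have hT : Fintype {x : Γ | x ∈ S ∨ x⁻¹ ∈ S} := hTfin.fintype
    set n : ℝ := (Fintype.card {x : Γ | x ∈ S ∨ x⁻¹ ∈ S} : ℝ) with hn
    have hn0 : 0 ≤ n := by positivity
    refine ⟨(n + 1)⁻¹, by positivity, ?_, ?_⟩
    · exact inv_le_one_of_one_le₀ (by linarith)
    · have hs := summable_list (T := {x : Γ | x ∈ S ∨ x⁻¹ ∈ S}) (r := (n + 1)⁻¹) (by positivity)
        (by rw [← hn, ← div_eq_mul_inv, div_lt_one (by linarith)]; linarith)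
      let ω' : Γ → List {x : Γ | x ∈ S ∨ x⁻¹ ∈ S} := fun g => (ω g).attachWith _ (h2 g)
      have hinj : Function.Injective ω' := by
        intro g h hgh
        have e : ∀ g, (ω' g).map Subtype.val = ω g := fun g =>
          List.attachWith_map_subtype_val _
        rw [h3 g, h3 h, ← e, ← e, hgh]
      refine (hs.comp_injective hinj).congr fun g => ?_
      simp [ω', h1]

theorem main {Γ : Type*} [Group Γ] [MetricSpace Γ] (S : Set Γ) (hS : IsWordMetric S)
    (Γi : ℕ → Subgroup Γ) (hnested : ∀ i, Γi (i + 1) ≤ Γi i)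
    (hnormal : ∀ i, (Γi i).Normal) (hfin : ∀ i, (Γi i).FiniteIndex)
    (htriv : (⨅ i, Γi i) = ⊥)
    {X : Type*} [MetricSpace X] (hbox : IsBoxSpace Γ Γi X)
    (p : ℝ≥0∞) [Fact (1 ≤ p)] (hp' : p ≠ ∞)
    (α : Type) [MeasurableSpace α] (μ : MeasureTheory.Measure α)
    (f : X → MeasureTheory.Lp ℝ p μ) (hf : IsCoarseEmbedding f) :
    HasPropertyPLp Γ p := by
  have hP1 : 1 ≤ p.toReal := by
    rw [← ENNReal.toReal_one]
    exact ENNReal.toReal_mono hp' Fact.out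
  obtain ⟨ℓ, hd, hsub, hword, r, hr0, hr1, hsum⟩ := word_length hS
  obtain ⟨ρ₁, ρ₂, hm1, hm2, ht1, ht2, hρ⟩ := hf
  have hsmall : ∀ N : ℕ, {g | ℓ g < N}.Finite := by
    intro N
    have h1 := hsum.tendsto_cofinite_zero.eventually (gt_mem_nhds (pow_pos hr0 N))
    refine Set.Finite.subset h1 fun g hg => ?_
    simp only [Set.mem_setOf_eq] at hg
    show ¬ (r ^ ℓ g < r ^ N)
    exact not_lt.2 (pow_le_pow_of_le_one hr0.le hr1 hg.le)
  have hcount : Countable Γ := by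
    have : (Set.univ : Set Γ) = ⋃ N : ℕ, {g | ℓ g < N} := by
      ext g
      simpa using ⟨ℓ g + 1, Nat.lt_succ_self _⟩
    rw [← Set.countable_univ_iff, this]
    exact Set.countable_iUnion fun N => (hsmall N).countable
  have hft : ∀ i, Fintype (Γ ⧸ Γi i) := fun i => Fintype.ofFinite _
  let e : Shrink.{0} Γ ≃* Γ := Shrink.mulEquiv
  have hcG : Countable (Shrink.{0} Γ) := e.injective.countable
  let φ : ∀ i, Shrink.{0} Γ →* Γ ⧸ Γi i := fun i => (QuotientGroup.mk' (Γi i)).comp e.toMonoidHom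
  let F : ∀ i, Γ ⧸ Γi i → Lp ℝ p μ := fun i x => f (hbox.emb ⟨i, x⟩)
  have hbdd : ∀ i (a b : Γ ⧸ Γi i), BddBelow {t : ℝ | ∃ g h : Γ, (g : Γ ⧸ Γi i) = a ∧
      (h : Γ ⧸ Γi i) = b ∧ t = dist g h} := by
    intro i a b
    refine ⟨0, ?_⟩
    rintro _ ⟨g, h, -, -, rfl⟩
    exact dist_nonneg
  have hupper : ∀ i (x : Γ ⧸ Γi i) (g : Γ),
      dist (hbox.emb ⟨i, x * (g : Γ ⧸ Γi i)⟩) (hbox.emb ⟨i, x⟩) ≤ ℓ g := by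
    intro i x g
    obtain ⟨k, rfl⟩ := QuotientGroup.mk_surjective x
    rw [dist_comm, hbox.dist_block]
    refine csInf_le (hbdd _ _ _) ⟨k, k * g, rfl, rfl, ?_⟩
    rw [hd]; simp
  set K : ℝ := max (ρ₂ 1) 0 with hK
  have hstep : ∀ i (x : Γ ⧸ Γi i) (g : Γ), ℓ g ≤ 1 → ‖F i (x * (g : Γ ⧸ Γi i)) - F i x‖ ≤ K := by
    intro i x g hg
    refine (hρ _ _).2.trans ((hm2 ((hupper i x g).trans ?_)).trans (le_max_left _ _))
    exact_mod_cast hg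
  have hlist : ∀ i (l : List Γ), (∀ y ∈ l, ℓ y ≤ 1) → ∀ x : Γ ⧸ Γi i,
      ‖F i (x * ((l.prod : Γ) : Γ ⧸ Γi i)) - F i x‖ ≤ K * l.length := by
    intro i l
    induction l with
    | nil => intro _ x; simp
    | cons y l ih =>
      intro hl x
      have h1 := ih (fun z hz => hl z (List.mem_cons_of_mem _ hz)) (x * (y : Γ ⧸ Γi i))
      have h2 := hstep i x y (hl y List.mem_cons_self)
      rw [List.prod_cons, List.length_cons, QuotientGroup.mk_mul, ← mul_assoc]
      have h3 := norm_sub_le_norm_sub_add_norm_sub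
        (F i (x * (y : Γ ⧸ Γi i) * ((l.prod : Γ) : Γ ⧸ Γi i))) (F i (x * (y : Γ ⧸ Γi i))) (F i x)
      push_cast
      linarith
  have hlin : ∀ i (g : Γ) (x : Γ ⧸ Γi i), ‖F i (x * (g : Γ ⧸ Γi i)) - F i x‖ ≤ K * ℓ g := by
    intro i g x
    obtain ⟨l, hl1, rfl, hl2⟩ := hword g
    rw [← hl2]
    exact hlist i l hl1 x
  have hlower : ∀ g : Γ, ∀ᶠ i in atTop, ∀ x : Γ ⧸ Γi i,
      (ℓ g : ℝ) ≤ dist (hbox.emb ⟨i, x * (g : Γ ⧸ Γi i)⟩) (hbox.emb ⟨i, x⟩) := by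
    intro g
    have hanti : Antitone Γi := antitone_nat_of_succ_le hnested
    have h1 : ∀ᶠ i in atTop, ∀ k ∈ {k | ℓ k < ℓ g}, k⁻¹ * g ∉ Γi i := by
      rw [eventually_all_finite (hsmall (ℓ g))]
      intro k hk
      have hne : k⁻¹ * g ≠ 1 := by
        intro h
        rw [inv_mul_eq_one] at h
        have hk' : ℓ k < ℓ g := by simpa using hk
        rw [h] at hk'
        exact lt_irrefl _ hk'
      have : k⁻¹ * g ∉ ⨅ i, Γi i := by rwa [htriv, Subgroup.mem_bot]
      rw [Subgroup.mem_iInf, not_forall] at this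
      obtain ⟨i₀, hi₀⟩ := this
      filter_upwards [eventually_ge_atTop i₀] with i hi hmem
      exact hi₀ (hanti hi hmem)
    filter_upwards [h1] with i hi x
    rw [dist_comm, hbox.dist_block]
    obtain ⟨k, rfl⟩ := QuotientGroup.mk_surjective x
    refine le_csInf ⟨_, k, k * g, rfl, rfl, rfl⟩ ?_
    rintro _ ⟨a, b, ha, hb, rfl⟩
    rw [hd]
    by_contra! hlt
    refine hi (a⁻¹ * b) (by exact_mod_cast hlt) ?_
    rw [← QuotientGroup.eq]
    have : ((a⁻¹ * b : Γ) : Γ ⧸ Γi i) = (a : Γ ⧸ Γi i)⁻¹ * (b : Γ ⧸ Γi i) := rfl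
    rw [this, hb, ha, inv_mul_cancel_left]
  have hs0 : 0 < r / 2 := by positivity
  have hs1 : r / 2 ≤ 1 := by linarith
  have key := core φ p hp' F (w := fun g => (r / 2) ^ ℓ (e g)) (fun g => by positivity)
    (fun g => pow_le_one₀ hs0.le hs1) (D := fun g => ((r / 2) ^ ℓ (e g))⁻¹) (by
      intro h g
      rw [le_inv_mul_iff₀ (by positivity), ← pow_add, map_mul]
      exact pow_le_pow_of_le_one hs0.le hs1 (hsub _ _))
    (R := fun g => K * ℓ (e g)) (fun i g x => hlin i (e g) x) (by
      have hsum' : Summable fun g : Shrink.{0} Γ => K ^ p.toReal * r ^ ℓ (e g) :=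
        (hsum.comp_injective e.injective).mul_left _
      have hK0 : 0 ≤ K := le_max_right _ _
      refine Summable.of_nonneg_of_le (fun g => by positivity) (fun g => ?_) hsum'
      have h1 : (r / 2) ^ ℓ (e g) * (K * ℓ (e g)) ≤ K * r ^ ℓ (e g) := by
        have h2 : ((ℓ (e g) : ℕ) : ℝ) ≤ 2 ^ ℓ (e g) := by
          exact_mod_cast (Nat.lt_two_pow_self).le
        have h3 : (r / 2) ^ ℓ (e g) * 2 ^ ℓ (e g) = r ^ ℓ (e g) := by
          rw [← mul_pow]; congr 1; ring
        calc (r / 2) ^ ℓ (e g) * (K * ℓ (e g)) ≤ (r / 2) ^ ℓ (e g) * (K * 2 ^ ℓ (e g)) := by gcongr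
          _ = K * ((r / 2) ^ ℓ (e g) * 2 ^ ℓ (e g)) := by ring
          _ = _ := by rw [h3]
      calc ((r / 2) ^ ℓ (e g) * (K * ℓ (e g))) ^ p.toReal ≤ (K * r ^ ℓ (e g)) ^ p.toReal :=
            Real.rpow_le_rpow (by positivity) h1 (by linarith)
        _ = K ^ p.toReal * (r ^ ℓ (e g)) ^ p.toReal := Real.mul_rpow hK0 (by positivity)
        _ ≤ K ^ p.toReal * r ^ ℓ (e g) := by
            refine mul_le_mul_of_nonneg_left ?_ (by positivity)
            exact Real.rpow_le_self_of_le_one (by positivity) (pow_le_one₀ hr0.le hr1) hP1)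
    (by
      intro A
      obtain ⟨T, hT⟩ := (tendsto_atTop.1 ht1 A).exists_forall_of_atTop
      obtain ⟨N, hN⟩ := exists_nat_ge T
      have h1 : ∀ᶠ g in (cofinite : Filter Γ), N ≤ ℓ g := by
        refine Set.Finite.subset (hsmall N) fun g hg => ?_
        simpa using hg
      have h2 := e.injective.tendsto_cofinite.eventually h1
      filter_upwards [h2] with g hg
      filter_upwards [hlower (e g)] with i hi x
      refine (hT _ ?_).trans (hρ _ _).1
      refine hN.trans (le_trans ?_ (hi x))
      exact_mod_cast hg)
  obtain ⟨β, mβ, ν, π, b, k1, k2, k3⟩ := key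
  refine ⟨β, mβ, ν, fun g => π (e.symm g), fun g => b (e.symm g), ?_, ?_, ?_⟩
  · intro g h v
    show π (e.symm (g * h)) v = π (e.symm g) (π (e.symm h) v)
    rw [map_mul, k1]
  · intro g h
    show b (e.symm (g * h)) = π (e.symm g) (b (e.symm h)) + b (e.symm g)
    rw [map_mul, k2]
  · exact k3.comp e.symm.injective.tendsto_cofinite

end BoxPL

/-- If a box space of a finitely generated residually finite group Γ coarsely embeds
into an L^p space (1 ≤ p < ∞) then Γ has property PL^p. -/
theorem stmt11 {Γ : Type*} [Group Γ] [MetricSpace Γ] (S : Set Γ) (hS : IsWordMetric S)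
    (Γi : ℕ → Subgroup Γ) (hnested : ∀ i, Γi (i + 1) ≤ Γi i)
    (hnormal : ∀ i, (Γi i).Normal) (hfin : ∀ i, (Γi i).FiniteIndex)
    (htriv : (⨅ i, Γi i) = ⊥)
    {X : Type*} [MetricSpace X] (hbox : IsBoxSpace Γ Γi X)
    (p : ℝ≥0∞) [Fact (1 ≤ p)] (hp' : p ≠ ∞)
    (α : Type) [MeasurableSpace α] (μ : MeasureTheory.Measure α)
    (f : X → MeasureTheory.Lp ℝ p μ) (hf : IsCoarseEmbedding f) :
    HasPropertyPLp Γ p := by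
  exact BoxPL.main S hS Γi hnested hnormal hfin htriv hbox p hp' α μ f hf
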